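/- Let E ⊂ ℙ¹ × ℙ¹ be a nonsingular curve of bidegree (2,2) over an algebraically closed field of characteristic ≠ 2. Then, after applying suitable automorphisms of the two factors ℙ¹, the bihomogeneous equation of E can be brought into Rohn's normal form a₁(x₀²y₀² + x₁²y₁²) + a₂(x₀²y₁² + x₁²y₀²) + 2a₃x₀x₁y₀y₁ = 0 with a₁a₂ ≠ 0; in this normal form the discriminant of the equation, viewed as a quadratic form in (y₀, y₁), equals x₁⁴ + b x₁²x₀² + x₀⁴ with b = (a₁² + a₂² − a₃²)/(a₁a₂) and b ≠ ±2. -/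

import Mathlib

namespace RQS

open MvPolynomial


open MvPolynomial

variable (K : Type) [Field K]

/-- Projective n-space modelled as the projectivization of `Fin n → K`
(so `PP K (n+1)` is ℙⁿ). -/
abbrev PP (n : ℕ) : Type := Projectivization K (Fin n → K)

variable {K}

/-- Vanishing of a (homogeneous) polynomial at a projective point. -/
def vanishes {n : ℕ} (p : MvPolynomial (Fin n) K) (x : PP K n) : Prop :=
  ∀ (v : Fin n → K) (h : v ≠ 0), Projectivization.mk K v h = x → eval v p = 0

/-- Projective zero locus of a set of polynomials. -/
def zeroLocus {n : ℕ} (S : Set (MvPolynomial (Fin n) K)) : Set (PP K n) :=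
  {x | ∀ p ∈ S, vanishes p x}

/-- Zariski closed subsets of projective space. -/
def ZClosed {n : ℕ} (X : Set (PP K n)) : Prop :=
  ∃ S : Set (MvPolynomial (Fin n) K), (∀ p ∈ S, ∃ d, p.IsHomogeneous d) ∧ X = zeroLocus S

/-- Irreducibility with respect to the Zariski topology. -/
def ZIrred {n : ℕ} (X : Set (PP K n)) : Prop :=
  X.Nonempty ∧ ∀ A B : Set (PP K n), ZClosed A → ZClosed B → X ⊆ A ∪ B → X ⊆ A ∨ X ⊆ B

/-- `X` contains a chain of closed irreducible subsets of length `d+1`. -/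
def dimGE {n : ℕ} (X : Set (PP K n)) (d : ℕ) : Prop :=
  ∃ f : Fin (d + 1) → Set (PP K n),
    (∀ i, ZClosed (f i) ∧ ZIrred (f i) ∧ f i ⊆ X) ∧ StrictMono f

/-- `X` has (Krull) dimension exactly `d`. -/
def HasDim {n : ℕ} (X : Set (PP K n)) (d : ℕ) : Prop := dimGE X d ∧ ¬ dimGE X (d + 1)

/-- The hyperplane with coefficient vector `φ`. -/
def hyp {n : ℕ} (φ : Fin n → K) : Set (PP K n) :=
  {x | ∀ (v : Fin n → K) (h : v ≠ 0), Projectivization.mk K v h = x → ∑ i, φ i * v i = 0}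

/-- Degree of a (reduced) curve: every hyperplane not containing it meets it in at most `d`
points, and some hyperplane meets it in exactly `d` points. -/
def HasCurveDeg {n : ℕ} (X : Set (PP K n)) (d : ℕ) : Prop :=
  (∀ φ : Fin n → K, φ ≠ 0 → ¬ X ⊆ hyp φ →
    (X ∩ hyp φ).Finite ∧ (X ∩ hyp φ).ncard ≤ d) ∧
  (∃ φ : Fin n → K, φ ≠ 0 ∧ ¬ X ⊆ hyp φ ∧ (X ∩ hyp φ).ncard = d)

/-- An irreducible projective curve of degree `d`. -/
def IsCurveOfDeg {n : ℕ} (X : Set (PP K n)) (d : ℕ) : Prop :=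
  ZClosed X ∧ ZIrred X ∧ HasDim X 1 ∧ HasCurveDeg X d

/-- A property holds at a general point of `S`. -/
def GenericPts {n : ℕ} (S : Set (PP K n)) (Q : PP K n → Prop) : Prop :=
  ∃ T : Set (PP K n), ZClosed T ∧ ¬ S ⊆ T ∧ ∀ p ∈ S, p ∉ T → Q p

/-! ### Plücker coordinates: `p₁₂,p₁₃,p₁₄,p₂₃,p₂₄,p₃₄` indexed by `0,…,5` -/

/-- Plücker coordinates of the line through `u` and `v`, i.e. the bivector `u ∧ v`. -/
def plucker (u v : Fin 4 → K) : Fin 6 → K :=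
  ![u 0 * v 1 - u 1 * v 0, u 0 * v 2 - u 2 * v 0, u 0 * v 3 - u 3 * v 0,
    u 1 * v 2 - u 2 * v 1, u 1 * v 3 - u 3 * v 1, u 2 * v 3 - u 3 * v 2]

/-- The Plücker quadric `p₁₂p₃₄ - p₁₃p₂₄ + p₁₄p₂₃`, i.e. `½ w ∧ w`. -/
def plQuad (w : Fin 6 → K) : K := w 0 * w 5 - w 1 * w 4 + w 2 * w 3

/-- The wedge pairing `w ∧ z ∈ Λ⁴V ≅ K` of two bivectors. -/
def plPair (w z : Fin 6 → K) : K :=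
  w 0 * z 5 + w 5 * z 0 - w 1 * z 4 - w 4 * z 1 + w 2 * z 3 + w 3 * z 2

/-- The wedge `w ∧ v ∈ Λ³V ≅ V*` of a bivector `w` with a vector `v`;
`w ∧ v = 0` expresses that the point `v̄` lies on the line `w̄`. -/
def wedgePt (w : Fin 6 → K) (v : Fin 4 → K) : Fin 4 → K :=
  ![w 0 * v 2 - w 1 * v 1 + w 3 * v 0,
    w 0 * v 3 - w 2 * v 1 + w 4 * v 0,
    w 1 * v 3 - w 2 * v 2 + w 5 * v 0,
    w 3 * v 3 - w 4 * v 2 + w 5 * v 1]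

/-- The set of points of ℙ³ on the line with Plücker vector `w`. -/
def lineOfRep (w : Fin 6 → K) : Set (PP K 4) :=
  {p | ∀ (v : Fin 4 → K) (h : v ≠ 0), Projectivization.mk K v h = p → wedgePt w v = 0}

/-- `w` represents a line of ℙ³: it is nonzero and decomposable. -/
def IsLineRep (w : Fin 6 → K) : Prop := w ≠ 0 ∧ plQuad w = 0

variable (K) in
/-- The Grassmannian `Gr(2,4) ⊂ ℙ⁵` of lines in ℙ³. -/
def grass : Set (PP K 6) :=
  {x | ∃ (w : Fin 6 → K) (h : w ≠ 0), Projectivization.mk K w h = x ∧ plQuad w = 0}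

/-- The line in ℙ³ corresponding to a point `x` of the Grassmannian. -/
def lineOf (x : PP K 6) : Set (PP K 4) :=
  {p | ∀ (w : Fin 6 → K) (h : w ≠ 0), Projectivization.mk K w h = x → p ∈ lineOfRep w}

/-- The set of (Grassmann points of) lines contained in a surface `S ⊂ ℙ³`. -/
def linesOf (S : Set (PP K 4)) : Set (PP K 6) :=
  {x | x ∈ grass K ∧ lineOf x ⊆ S}

/-- A ruled surface: an irreducible closed surface which is a union of lines. -/
def IsRuled (S : Set (PP K 4)) : Prop :=
  ZClosed S ∧ ZIrred S ∧ HasDim S 2 ∧ ∀ p ∈ S, ∃ x ∈ linesOf S, p ∈ lineOf x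

/-- Degree of a surface in ℙ³ via intersections with lines. -/
def HasSurfDeg (S : Set (PP K 4)) (d : ℕ) : Prop :=
  (∀ w : Fin 6 → K, IsLineRep w → ¬ lineOfRep w ⊆ S →
    (S ∩ lineOfRep w).Finite ∧ (S ∩ lineOfRep w).ncard ≤ d) ∧
  (∃ w : Fin 6 → K, IsLineRep w ∧ ¬ lineOfRep w ⊆ S ∧ (S ∩ lineOfRep w).ncard = d)

/-- A cone: all lines of `S` pass through a common point. -/
def IsCone (S : Set (PP K 4)) : Prop :=
  ∃ p : PP K 4, ∀ x ∈ linesOf S, p ∈ lineOf x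

/-- `σ₂(p₀)`: the 2-plane in the Grassmannian of all lines through `p₀`. -/
def sigma2 (p₀ : PP K 4) : Set (PP K 6) := {x | x ∈ grass K ∧ p₀ ∈ lineOf x}

/-- The projective tangent space `T_{Gr,x₀}` of the Plücker quadric at `x₀`,
namely the hyperplane `{z̄ : w₀ ∧ z = 0}`. -/
def tangentGr (x₀ : PP K 6) : Set (PP K 6) :=
  {x | ∀ (w : Fin 6 → K) (h : w ≠ 0), Projectivization.mk K w h = x →
    ∀ (w₀ : Fin 6 → K) (h₀ : w₀ ≠ 0), Projectivization.mk K w₀ h₀ = x₀ → plPair w₀ w = 0}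

/-- The linear span of (the representatives of) a subset of projective space. -/
def spanOfSet {n : ℕ} (X : Set (PP K n)) : Submodule K (Fin n → K) :=
  Submodule.span K {v | ∃ h : v ≠ 0, Projectivization.mk K v h ∈ X}

/-- The projective subspace associated to a linear subspace. -/
def projSub {n : ℕ} (U : Submodule K (Fin n → K)) : Set (PP K n) :=
  {x | ∀ (v : Fin n → K) (h : v ≠ 0), Projectivization.mk K v h = x → v ∈ U}

/-- `P(C)`: the smallest projective subspace containing `C`. -/
def projSpanOf {n : ℕ} (X : Set (PP K n)) : Set (PP K n) := projSub (spanOfSet X)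

/-! ### Smoothness via Jacobian criteria -/

/-- The homogeneous polynomials vanishing on `X`. -/
def homIdeal {n : ℕ} (X : Set (PP K n)) : Set (MvPolynomial (Fin n) K) :=
  {p | (∃ d, p.IsHomogeneous d) ∧ ∀ x ∈ X, vanishes p x}

/-- The span of the gradients at `v` of all homogeneous polynomials vanishing on `X`. -/
def gradSpan {n : ℕ} (X : Set (PP K n)) (v : Fin n → K) : Submodule K (Fin n → K) :=
  Submodule.span K
    {g | ∃ p ∈ homIdeal X, g = fun i => eval v (pderiv i p)}

/-- Smooth point of a projective *curve* `X ⊂ ℙ(Kⁿ)` (Jacobian criterion: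
the affine cone over `X` has a 2-dimensional tangent space there). -/
def CurveSmoothPt {n : ℕ} (X : Set (PP K n)) (x : PP K n) : Prop :=
  ∀ (v : Fin n → K) (h : v ≠ 0), Projectivization.mk K v h = x →
    Module.finrank K (gradSpan X v) = n - 2

/-- Smooth point of a *surface* `S ⊂ ℙ³` (Jacobian criterion). -/
def SurfSmoothPt (S : Set (PP K 4)) (x : PP K 4) : Prop :=
  ∀ (v : Fin 4 → K) (h : v ≠ 0), Projectivization.mk K v h = x →
    Module.finrank K (gradSpan S v) = 1

/-- The singular locus of a surface `S ⊂ ℙ³`. -/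
def singLocus (S : Set (PP K 4)) : Set (PP K 4) := {x ∈ S | ¬ SurfSmoothPt S x}


/-! ### Products of projective spaces -/

/-- Vanishing of a bihomogeneous polynomial at a point of `ℙ^(a-1) × ℙ^(b-1)`. -/
def vanishes2 {a b : ℕ} (p : MvPolynomial (Fin a ⊕ Fin b) K) (x : PP K a × PP K b) : Prop :=
  ∀ (u : Fin a → K) (hu : u ≠ 0) (v : Fin b → K) (hv : v ≠ 0),
    Projectivization.mk K u hu = x.1 → Projectivization.mk K v hv = x.2 →
      eval (Sum.elim u v) p = 0

/-- Bihomogeneous polynomial (of some bidegree). -/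
def IsBiHomog {a b : ℕ} (p : MvPolynomial (Fin a ⊕ Fin b) K) : Prop :=
  ∃ d e : ℕ, IsWeightedHomogeneous (Sum.elim (fun _ => (1:ℕ)) (fun _ => 0)) p d ∧
    IsWeightedHomogeneous (Sum.elim (fun _ => (0:ℕ)) (fun _ => 1)) p e

/-- Bihomogeneous polynomial of bidegree `(d,e)`. -/
def IsBiHomogOf {a b : ℕ} (p : MvPolynomial (Fin a ⊕ Fin b) K) (d e : ℕ) : Prop :=
  IsWeightedHomogeneous (Sum.elim (fun _ => (1:ℕ)) (fun _ => 0)) p d ∧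
    IsWeightedHomogeneous (Sum.elim (fun _ => (0:ℕ)) (fun _ => 1)) p e

def zeroLocus2 {a b : ℕ} (S : Set (MvPolynomial (Fin a ⊕ Fin b) K)) :
    Set (PP K a × PP K b) :=
  {x | ∀ p ∈ S, vanishes2 p x}

def ZClosed2 {a b : ℕ} (X : Set (PP K a × PP K b)) : Prop :=
  ∃ S : Set (MvPolynomial (Fin a ⊕ Fin b) K), (∀ p ∈ S, IsBiHomog p) ∧ X = zeroLocus2 S

def ZIrred2 {a b : ℕ} (X : Set (PP K a × PP K b)) : Prop :=
  X.Nonempty ∧ ∀ A B : Set (PP K a × PP K b), ZClosed2 A → ZClosed2 B → X ⊆ A ∪ B →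
    X ⊆ A ∨ X ⊆ B

def dimGE2 {a b : ℕ} (X : Set (PP K a × PP K b)) (d : ℕ) : Prop :=
  ∃ f : Fin (d + 1) → Set (PP K a × PP K b),
    (∀ i, ZClosed2 (f i) ∧ ZIrred2 (f i) ∧ f i ⊆ X) ∧ StrictMono f

def HasDim2 {a b : ℕ} (X : Set (PP K a × PP K b)) (d : ℕ) : Prop :=
  dimGE2 X d ∧ ¬ dimGE2 X (d + 1)


/-- The automorphism of projective space induced by a linear automorphism
(a projective coordinate change). -/
def projMap {n : ℕ} (A : (Fin n → K) ≃ₗ[K] (Fin n → K)) : PP K n → PP K n :=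
  Projectivization.map A.toLinearMap A.injective

/-- Two subsets of projective space are projectively equivalent. -/
def ProjEquiv {n : ℕ} (S T : Set (PP K n)) : Prop :=
  ∃ A : (Fin n → K) ≃ₗ[K] (Fin n → K), projMap A '' S = T

/-! STATEMENT 18: Rohn's normal form for a nonsingular `(2,2)`-curve in ℙ¹ × ℙ¹. -/

/-- Rohn's normal form `a₁(x₀²y₀² + x₁²y₁²) + a₂(x₀²y₁² + x₁²y₀²) + 2a₃x₀x₁y₀y₁`,
with `x`-variables `Sum.inl` and `y`-variables `Sum.inr`. -/
noncomputable def rohnForm {K : Type} [Field K] (a₁ a₂ a₃ : K) :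
    MvPolynomial (Fin 2 ⊕ Fin 2) K :=
  C a₁ * (X (Sum.inl 0) ^ 2 * X (Sum.inr 0) ^ 2 + X (Sum.inl 1) ^ 2 * X (Sum.inr 1) ^ 2) +
  C a₂ * (X (Sum.inl 0) ^ 2 * X (Sum.inr 1) ^ 2 + X (Sum.inl 1) ^ 2 * X (Sum.inr 0) ^ 2) +
  2 * C a₃ * (X (Sum.inl 0) * X (Sum.inl 1) * X (Sum.inr 0) * X (Sum.inr 1))

/-- The discriminant `B² − 4AC` of Rohn's normal form viewed as a quadratic form in
`(y₀,y₁)`, a binary quartic in `(x₀,x₁)`:  here `A = a₁x₀² + a₂x₁²`, `B = 2a₃x₀x₁`,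
`C = a₂x₀² + a₁x₁²`. -/
noncomputable def rohnDisc {K : Type} [Field K] (a₁ a₂ a₃ : K) :
    MvPolynomial (Fin 2) K :=
  (2 * C a₃ * (X 0 * X 1)) ^ 2 -
    4 * (C a₁ * X 0 ^ 2 + C a₂ * X 1 ^ 2) * (C a₂ * X 0 ^ 2 + C a₁ * X 1 ^ 2)

/-! ### Binary quadratic forms -/

/-- The binary quadratic form `Q₀x² + Q₁xy + Q₂y²` after the substitution
`(x, y) ↦ T (x, y)`. -/
def quadComp (Q : Fin 3 → K) (T : Matrix (Fin 2) (Fin 2) K) : Fin 3 → K :=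
  ![Q 0 * T 0 0 ^ 2 + Q 1 * T 0 0 * T 1 0 + Q 2 * T 1 0 ^ 2,
    2 * Q 0 * T 0 0 * T 0 1 + Q 1 * (T 0 0 * T 1 1 + T 0 1 * T 1 0) + 2 * Q 2 * T 1 0 * T 1 1,
    Q 0 * T 0 1 ^ 2 + Q 1 * T 0 1 * T 1 1 + Q 2 * T 1 1 ^ 2]

/-- The value of a binary quadratic form. -/
def quadEval (Q : Fin 3 → K) (v : Fin 2 → K) : K :=
  Q 0 * v 0 ^ 2 + Q 1 * v 0 * v 1 + Q 2 * v 1 ^ 2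

/-- The polarization of the discriminant of binary quadratic forms. -/
def quadPolar (Q R : Fin 3 → K) : K := Q 1 * R 1 - 2 * (Q 0 * R 2 + Q 2 * R 0)

theorem quadComp_mul (Q : Fin 3 → K) (S T : Matrix (Fin 2) (Fin 2) K) :
    quadComp Q (S * T) = quadComp (quadComp Q S) T := by
  funext i
  fin_cases i <;> simp [quadComp, Matrix.mul_apply, Fin.sum_univ_two] <;> ring

theorem quadEval_comp (Q : Fin 3 → K) (T : Matrix (Fin 2) (Fin 2) K) (v : Fin 2 → K) :
    quadEval (quadComp Q T) v = quadEval Q (T.mulVec v) := by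
  simp [quadEval, quadComp, Matrix.mulVec, dotProduct, Fin.sum_univ_two]
  ring

theorem quadPolar_comp (Q R : Fin 3 → K) (T : Matrix (Fin 2) (Fin 2) K) :
    quadPolar (quadComp Q T) (quadComp R T) = T.det ^ 2 * quadPolar Q R := by
  simp [quadPolar, quadComp, Matrix.det_fin_two]
  ring

theorem exists_sq_eq [IsAlgClosed K] (x : K) : ∃ z, z ^ 2 = x :=
  IsAlgClosed.exists_pow_nat_eq x two_pos

/-- A nondegenerate binary quadratic form is a product of independent linear forms. -/
theorem exists_quadComp_eq_mul [IsAlgClosed K] (h2 : (2 : K) ≠ 0) (Q : Fin 3 → K)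
    (hQ : quadPolar Q Q ≠ 0) :
    ∃ T : Matrix (Fin 2) (Fin 2) K, T.det ≠ 0 ∧ ∃ c ≠ 0, quadComp Q T = ![0, c, 0] := by
  suffices H : ∃ T : Matrix (Fin 2) (Fin 2) K, T.det ≠ 0 ∧
      quadComp Q T 0 = 0 ∧ quadComp Q T 2 = 0 by
    obtain ⟨T, hT, h0, h2'⟩ := H
    have hdisc := quadPolar_comp Q Q T
    refine ⟨T, hT, quadComp Q T 1, ?_, ?_⟩
    · intro h1
      have : quadPolar (quadComp Q T) (quadComp Q T) = 0 := by
        simp only [quadPolar, h0, h1, h2']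
        ring
      rw [this] at hdisc
      exact mul_ne_zero (pow_ne_zero 2 hT) hQ hdisc.symm
    · funext i
      fin_cases i
      · exact h0
      · rfl
      · exact h2'
  obtain ⟨d, hd⟩ := exists_sq_eq (quadPolar Q Q)
  have hd0 : d ≠ 0 := by
    rintro rfl
    exact hQ (by rw [← hd]; ring)
  simp only [quadPolar] at hd hQ
  by_cases ha : Q 0 = 0
  · refine ⟨!![1, -Q 2; 0, Q 1], ?_, ?_, ?_⟩
    · intro h
      have h1 : Q 1 = 0 := by simpa [Matrix.det_fin_two] using h
      exact hQ (by rw [ha, h1]; ring)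
    · simp [quadComp, ha]
    · simp [quadComp, ha]
      ring
  · refine ⟨!![-Q 1 + d, -Q 1 - d; 2 * Q 0, 2 * Q 0], ?_, ?_, ?_⟩
    · have : (!![-Q 1 + d, -Q 1 - d; 2 * Q 0, 2 * Q 0] : Matrix (Fin 2) (Fin 2) K).det
          = 2 * 2 * Q 0 * d := by
        simp [Matrix.det_fin_two]
        ring
      rw [this]
      exact mul_ne_zero (mul_ne_zero (mul_ne_zero h2 h2) ha) hd0
    · simp [quadComp]
      linear_combination Q 0 * hd
    · simp [quadComp]
      linear_combination Q 0 * hd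

/-- Two orthogonal nondegenerate binary quadratic forms are simultaneously proportional to
`xy` and `x² + y²`. -/
theorem exists_quadComp_pair [IsAlgClosed K] (h2 : (2 : K) ≠ 0) (Q R : Fin 3 → K)
    (hQ : quadPolar Q Q ≠ 0) (hR : quadPolar R R ≠ 0) (hQR : quadPolar Q R = 0) :
    ∃ T : Matrix (Fin 2) (Fin 2) K, T.det ≠ 0 ∧ (∃ c ≠ 0, quadComp Q T = ![0, c, 0]) ∧
      ∃ c ≠ 0, quadComp R T = ![c, 0, c] := by
  obtain ⟨T, hT, c, hc, hQT⟩ := exists_quadComp_eq_mul h2 Q hQ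
  have hpQR := quadPolar_comp Q R T
  have hpR := quadPolar_comp R R T
  have hne : quadPolar (quadComp R T) (quadComp R T) ≠ 0 := by
    rw [hpR]
    exact mul_ne_zero (pow_ne_zero 2 hT) hR
  rw [hQR, hQT] at hpQR
  have h1 : quadComp R T 1 = 0 := by
    have : c * quadComp R T 1 = 0 := by simpa [quadPolar] using hpQR
    exact (mul_eq_zero.mp this).resolve_left hc
  have h0 : quadComp R T 0 ≠ 0 := fun h => hne (by simp [quadPolar, h, h1])
  have h2' : quadComp R T 2 ≠ 0 := fun h => hne (by simp [quadPolar, h, h1])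
  obtain ⟨s, hs⟩ := exists_sq_eq (quadComp R T 2 / quadComp R T 0)
  have hs' : quadComp R T 0 * s ^ 2 = quadComp R T 2 := by
    rw [hs]
    field_simp
  have hs0 : s ≠ 0 := by
    rintro rfl
    exact h2' (by rw [← hs']; ring)
  refine ⟨T * !![s, 0; 0, 1], ?_, ⟨c * s, mul_ne_zero hc hs0, ?_⟩, quadComp R T 2, h2', ?_⟩
  · rw [Matrix.det_mul]
    simpa [Matrix.det_fin_two_of] using ⟨hT, hs0⟩
  · rw [quadComp_mul, hQT]
    funext i
    fin_cases i <;> simp [quadComp]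
  · rw [quadComp_mul]
    generalize quadComp R T = V at *
    funext i
    fin_cases i <;> simp [quadComp, h1, hs']

/-- Three mutually orthogonal binary quadratic forms, at most one of which is degenerate, are
simultaneously proportional to `x² + y²`, `x² - y²` and `xy`. -/
theorem exists_quadComp_triple [IsAlgClosed K] (h2 : (2 : K) ≠ 0) (P Q R : Fin 3 → K)
    (hPQ : quadPolar P Q = 0) (hPR : quadPolar P R = 0) (hQR : quadPolar Q R = 0)
    (hnPQ : quadPolar P P ≠ 0 ∨ quadPolar Q Q ≠ 0)
    (hnPR : quadPolar P P ≠ 0 ∨ quadPolar R R ≠ 0)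
    (hnQR : quadPolar Q Q ≠ 0 ∨ quadPolar R R ≠ 0) :
    ∃ T : Matrix (Fin 2) (Fin 2) K, T.det ≠ 0 ∧ ∃ p q r : K,
      quadComp P T = ![p, 0, p] ∧ quadComp Q T = ![q, 0, -q] ∧ quadComp R T = ![0, r, 0] := by
  have polar_comm : ∀ A B : Fin 3 → K, quadPolar A B = quadPolar B A := fun A B => by
    simp only [quadPolar]
    ring
  obtain ⟨i, hi⟩ := exists_sq_eq (-1 : K)
  have hi0 : i ≠ 0 := by
    rintro rfl
    simp at hi
  have ortho : ∀ (A B : Fin 3 → K) (T : Matrix (Fin 2) (Fin 2) K), quadPolar A B = 0 →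
      quadPolar (quadComp A T) (quadComp B T) = 0 := fun A B T h => by
    rw [quadPolar_comp, h, mul_zero]
  by_cases hR : quadPolar R R = 0
  · have hP := hnPR.resolve_right (not_not.mpr hR)
    have hQ := hnQR.resolve_right (not_not.mpr hR)
    obtain ⟨T, hT, ⟨c, hc, hPT⟩, d, hd, hQT⟩ := exists_quadComp_pair h2 P Q hP hQ hPQ
    have hPT' : quadComp P (T * !![1, i; 1, -i]) = ![c, 0, c] := by
      rw [quadComp_mul, hPT]
      funext j
      fin_cases j <;> simp [quadComp]
      linear_combination -c * hi
    have hQT' : quadComp Q (T * !![1, i; 1, -i]) = ![2 * d, 0, -(2 * d)] := by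
      rw [quadComp_mul, hQT]
      funext j
      fin_cases j <;> simp [quadComp]
      · ring
      · linear_combination 2 * d * hi
    have hPR' := ortho P R (T * !![1, i; 1, -i]) hPR
    have hQR' := ortho Q R (T * !![1, i; 1, -i]) hQR
    rw [hPT'] at hPR'
    rw [hQT'] at hQR'
    refine ⟨_, ?_, c, 2 * d, quadComp R (T * !![1, i; 1, -i]) 1, hPT', hQT', ?_⟩
    · rw [Matrix.det_mul]
      refine mul_ne_zero hT ?_
      have : (!![1, i; 1, -i] : Matrix (Fin 2) (Fin 2) K).det = -(2 * i) := by
        simp [Matrix.det_fin_two]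
        ring
      rw [this]
      exact neg_ne_zero.mpr (mul_ne_zero h2 hi0)
    · generalize quadComp R (T * !![1, i; 1, -i]) = V at *
      simp [quadPolar, h2] at hPR' hQR'
      have e1 : V 2 + V 0 = 0 := by
        have : c * (V 2 + V 0) = 0 := by linear_combination hPR'
        simpa [hc] using this
      have e2 : V 2 - V 0 = 0 := by
        have : d * 2 * (V 2 - V 0) = 0 := by linear_combination hQR'
        simpa [hd, h2] using this
      have v0 : V 0 = 0 := by
        have : 2 * V 0 = 0 := by linear_combination e1 - e2
        simpa [h2] using this
      have v2 : V 2 = 0 := by linear_combination e2 + v0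
      funext j
      fin_cases j <;> simp [v0, v2]
  · by_cases hP : quadPolar P P = 0
    · have hQ := hnPQ.resolve_left (not_not.mpr hP)
      obtain ⟨T, hT, ⟨c, hc, hRT⟩, d, hd, hQT⟩ :=
        exists_quadComp_pair h2 R Q hR hQ (by rw [polar_comm, hQR])
      have hRT' : quadComp R (T * !![1, 0; 0, i]) = ![0, c * i, 0] := by
        rw [quadComp_mul, hRT]
        funext j
        fin_cases j <;> simp [quadComp]
      have hQT' : quadComp Q (T * !![1, 0; 0, i]) = ![d, 0, -d] := by
        rw [quadComp_mul, hQT]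
        funext j
        fin_cases j <;> simp [quadComp, hi]
      have hPR' := ortho P R (T * !![1, 0; 0, i]) hPR
      have hPQ' := ortho P Q (T * !![1, 0; 0, i]) hPQ
      rw [hRT'] at hPR'
      rw [hQT'] at hPQ'
      refine ⟨_, ?_, quadComp P (T * !![1, 0; 0, i]) 0, d, c * i, ?_, hQT', hRT'⟩
      · rw [Matrix.det_mul]
        simpa [Matrix.det_fin_two_of] using ⟨hT, hi0⟩
      · generalize quadComp P (T * !![1, 0; 0, i]) = V at *
        simp [quadPolar, hc, hi0, h2] at hPR' hPQ'
        have e : V 2 = V 0 := by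
          have : d * (V 2 - V 0) = 0 := by linear_combination hPQ'
          simpa [hd, sub_eq_zero] using this
        funext j
        fin_cases j <;> simp [e, hPR']
    · obtain ⟨T, hT, ⟨c, hc, hRT⟩, d, hd, hPT⟩ :=
        exists_quadComp_pair h2 R P hR hP (by rw [polar_comm, hPR])
      have hQR' := ortho Q R T hQR
      have hPQ' := ortho P Q T hPQ
      rw [hRT] at hQR'
      rw [hPT] at hPQ'
      refine ⟨T, hT, d, quadComp Q T 0, c, hPT, ?_, hRT⟩
      generalize quadComp Q T = V at *
      simp [quadPolar, hc, h2] at hQR' hPQ'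
      have e : V 2 = -V 0 := by
        have : d * (V 2 + V 0) = 0 := by linear_combination hPQ'
        simpa [hd, add_eq_zero_iff_eq_neg] using this
      funext j
      fin_cases j <;> simp [e, hQR']

/-! ### Binary quartic forms -/

/-- The binary quartic form `e₀x⁴ + e₁x³y + e₂x²y² + e₃xy³ + e₄y⁴`. -/
@[ext]
structure BinaryQuartic (K : Type) where
  e₀ : K
  e₁ : K
  e₂ : K
  e₃ : K
  e₄ : K

namespace BinaryQuartic

/-- The substitution `(x, y) ↦ T (x, y)` in a binary quartic form. -/
def comp (D : BinaryQuartic K) (T : Matrix (Fin 2) (Fin 2) K) : BinaryQuartic K where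
  e₀ := D.e₀ * T 0 0 ^ 4 + D.e₁ * T 0 0 ^ 3 * T 1 0 + D.e₂ * T 0 0 ^ 2 * T 1 0 ^ 2 +
    D.e₃ * T 0 0 * T 1 0 ^ 3 + D.e₄ * T 1 0 ^ 4
  e₁ := 4 * D.e₀ * T 0 0 ^ 3 * T 0 1 +
    D.e₁ * (3 * T 0 0 ^ 2 * T 0 1 * T 1 0 + T 0 0 ^ 3 * T 1 1) +
    D.e₂ * (2 * T 0 0 * T 0 1 * T 1 0 ^ 2 + 2 * T 0 0 ^ 2 * T 1 0 * T 1 1) +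
    D.e₃ * (T 0 1 * T 1 0 ^ 3 + 3 * T 0 0 * T 1 0 ^ 2 * T 1 1) + 4 * D.e₄ * T 1 0 ^ 3 * T 1 1
  e₂ := 6 * D.e₀ * T 0 0 ^ 2 * T 0 1 ^ 2 +
    D.e₁ * (3 * T 0 0 * T 0 1 ^ 2 * T 1 0 + 3 * T 0 0 ^ 2 * T 0 1 * T 1 1) +
    D.e₂ * (T 0 1 ^ 2 * T 1 0 ^ 2 + 4 * T 0 0 * T 0 1 * T 1 0 * T 1 1 +
      T 0 0 ^ 2 * T 1 1 ^ 2) +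
    D.e₃ * (3 * T 0 1 * T 1 0 ^ 2 * T 1 1 + 3 * T 0 0 * T 1 0 * T 1 1 ^ 2) +
    6 * D.e₄ * T 1 0 ^ 2 * T 1 1 ^ 2
  e₃ := 4 * D.e₀ * T 0 1 ^ 3 * T 0 0 +
    D.e₁ * (3 * T 0 1 ^ 2 * T 0 0 * T 1 1 + T 0 1 ^ 3 * T 1 0) +
    D.e₂ * (2 * T 0 1 * T 0 0 * T 1 1 ^ 2 + 2 * T 0 1 ^ 2 * T 1 1 * T 1 0) +
    D.e₃ * (T 0 0 * T 1 1 ^ 3 + 3 * T 0 1 * T 1 1 ^ 2 * T 1 0) + 4 * D.e₄ * T 1 1 ^ 3 * T 1 0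
  e₄ := D.e₀ * T 0 1 ^ 4 + D.e₁ * T 0 1 ^ 3 * T 1 1 + D.e₂ * T 0 1 ^ 2 * T 1 1 ^ 2 +
    D.e₃ * T 0 1 * T 1 1 ^ 3 + D.e₄ * T 1 1 ^ 4

theorem comp_mul (D : BinaryQuartic K) (S T : Matrix (Fin 2) (Fin 2) K) :
    D.comp (S * T) = (D.comp S).comp T := by
  ext <;> simp only [comp, Matrix.mul_apply, Fin.sum_univ_two] <;> ring

/-- A binary quartic form has no multiple root if no change of coordinates makes it divisible
by `y²`. -/
def HasSimpleRoots (D : BinaryQuartic K) : Prop :=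
  ∀ T : Matrix (Fin 2) (Fin 2) K, T.det ≠ 0 → (D.comp T).e₀ = 0 → (D.comp T).e₁ ≠ 0

theorem HasSimpleRoots.comp {D : BinaryQuartic K} (hD : D.HasSimpleRoots)
    {S : Matrix (Fin 2) (Fin 2) K} (hS : S.det ≠ 0) : (D.comp S).HasSimpleRoots := by
  intro T hT
  rw [← comp_mul]
  exact hD (S * T) (by rw [Matrix.det_mul]; exact mul_ne_zero hS hT)

theorem HasSimpleRoots.e₁_ne_zero {D : BinaryQuartic K} (hD : D.HasSimpleRoots)
    (h : D.e₀ = 0) : D.e₁ ≠ 0 := by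
  simpa [BinaryQuartic.comp, h] using hD 1 (by simp)

theorem HasSimpleRoots.e₃_ne_zero {D : BinaryQuartic K} (hD : D.HasSimpleRoots)
    (h : D.e₄ = 0) : D.e₃ ≠ 0 := by
  simpa [BinaryQuartic.comp, h] using hD !![0, 1; 1, 0] (by simp [Matrix.det_fin_two])

theorem exists_quartic_root [IsAlgClosed K] (a b c d e : K) (h : a ≠ 0 ∨ b ≠ 0) :
    ∃ t : K, a * t ^ 4 + b * t ^ 3 + c * t ^ 2 + d * t + e = 0 := by
  let p : Polynomial K := .C a * .X ^ 4 + .C b * .X ^ 3 + .C c * .X ^ 2 + .C d * .X + .C e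
  have hp : p.degree ≠ 0 := by
    intro hdeg
    have hC := Polynomial.eq_C_of_degree_eq_zero hdeg
    have h4 := congrArg (Polynomial.coeff · 4) hC
    have h3 := congrArg (Polynomial.coeff · 3) hC
    simp [p, Polynomial.coeff_X, Polynomial.coeff_C, Polynomial.coeff_X_pow] at h3 h4
    exact h.elim (· h4) (· h3)
  obtain ⟨t, ht⟩ := IsAlgClosed.exists_root p hp
  exact ⟨t, by simpa [p] using ht⟩

theorem exists_comp_e₀_eq_zero [IsAlgClosed K] (D : BinaryQuartic K) :
    ∃ T : Matrix (Fin 2) (Fin 2) K, T.det ≠ 0 ∧ (D.comp T).e₀ = 0 := by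
  by_cases h : D.e₀ = 0
  · exact ⟨1, by simp, by simp [BinaryQuartic.comp, h]⟩
  · obtain ⟨t, ht⟩ := exists_quartic_root D.e₀ D.e₁ D.e₂ D.e₃ D.e₄ (Or.inl h)
    exact ⟨!![t, 1; 1, 0], by simp [Matrix.det_fin_two], by simpa [BinaryQuartic.comp] using ht⟩

theorem HasSimpleRoots.exists_comp_e₀_e₄_eq_zero [IsAlgClosed K] {D : BinaryQuartic K}
    (hD : D.HasSimpleRoots) :
    ∃ T : Matrix (Fin 2) (Fin 2) K, T.det ≠ 0 ∧ (D.comp T).e₀ = 0 ∧ (D.comp T).e₄ = 0 := by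
  obtain ⟨S, hS, h0⟩ := exists_comp_e₀_eq_zero D
  obtain ⟨t, ht⟩ := exists_quartic_root (D.comp S).e₀ (D.comp S).e₁ (D.comp S).e₂ (D.comp S).e₃
    (D.comp S).e₄ (Or.inr ((hD.comp hS).e₁_ne_zero h0))
  refine ⟨S * !![1, t; 0, 1], ?_, ?_, ?_⟩
  · simpa [Matrix.det_mul, Matrix.det_fin_two_of] using hS
  · rw [comp_mul]
    generalize D.comp S = E at *
    simp [BinaryQuartic.comp, h0]
  · rw [comp_mul]
    generalize D.comp S = E at *
    simpa [BinaryQuartic.comp] using ht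

theorem HasSimpleRoots.exists_comp_eq_even [IsAlgClosed K] (h2 : (2 : K) ≠ 0)
    {D : BinaryQuartic K} (hD : D.HasSimpleRoots) :
    ∃ T : Matrix (Fin 2) (Fin 2) K, T.det ≠ 0 ∧ (D.comp T).e₁ = 0 ∧ (D.comp T).e₃ = 0 := by
  obtain ⟨S, hS, h0, h4⟩ := hD.exists_comp_e₀_e₄_eq_zero
  have h1 := (hD.comp hS).e₁_ne_zero h0
  have h3 := (hD.comp hS).e₃_ne_zero h4
  obtain ⟨s, hs⟩ := exists_sq_eq ((D.comp S).e₃ / (D.comp S).e₁)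
  have hs' : (D.comp S).e₁ * s ^ 2 = (D.comp S).e₃ := by
    rw [hs]
    field_simp
  have hs0 : s ≠ 0 := by
    rintro rfl
    exact h3 (by rw [← hs']; ring)
  refine ⟨S * !![s, s; 1, -1], ?_, ?_, ?_⟩
  · rw [Matrix.det_mul]
    refine mul_ne_zero hS ?_
    have : (!![s, s; 1, -1] : Matrix (Fin 2) (Fin 2) K).det = -(2 * s) := by
      simp [Matrix.det_fin_two]
      ring
    rw [this]
    exact neg_ne_zero.mpr (mul_ne_zero h2 hs0)
  · rw [comp_mul]
    generalize D.comp S = E at *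
    simp [BinaryQuartic.comp, h0, h4]
    linear_combination 2 * s * hs'
  · rw [comp_mul]
    generalize D.comp S = E at *
    simp [BinaryQuartic.comp, h0, h4]
    linear_combination (-2) * s * hs'

/-- A binary quartic form without multiple roots is equivalent to a multiple of
`x⁴ + bx²y² + y⁴` with `b ≠ ±2`. -/
theorem HasSimpleRoots.exists_comp_eq [IsAlgClosed K] (h2 : (2 : K) ≠ 0)
    {D : BinaryQuartic K} (hD : D.HasSimpleRoots) :
    ∃ T : Matrix (Fin 2) (Fin 2) K, T.det ≠ 0 ∧ ∃ c b : K, c ≠ 0 ∧ b ≠ 2 ∧ b ≠ -2 ∧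
      D.comp T = ⟨c, 0, c * b, 0, c⟩ := by
  obtain ⟨S, hS, h1, h3⟩ := hD.exists_comp_eq_even h2
  have h0 : (D.comp S).e₀ ≠ 0 := fun h => (hD.comp hS).e₁_ne_zero h h1
  have h4 : (D.comp S).e₄ ≠ 0 := fun h => (hD.comp hS).e₃_ne_zero h h3
  obtain ⟨w, hw⟩ := IsAlgClosed.exists_pow_nat_eq ((D.comp S).e₄ / (D.comp S).e₀)
    (n := 4) (by norm_num)
  have hw' : (D.comp S).e₀ * w ^ 4 = (D.comp S).e₄ := by
    rw [hw]
    field_simp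
  have hw0 : w ≠ 0 := by
    rintro rfl
    exact h4 (by rw [← hw']; ring)
  have hT : (S * !![w, 0; 0, 1]).det ≠ 0 := by
    rw [Matrix.det_mul]
    simpa [Matrix.det_fin_two_of] using ⟨hS, hw0⟩
  obtain ⟨c, hc⟩ : ∃ c, c = (D.comp S).e₄ := ⟨_, rfl⟩
  obtain ⟨b, hb⟩ : ∃ b, b = (D.comp S).e₂ * w ^ 2 / (D.comp S).e₄ := ⟨_, rfl⟩
  have key : D.comp (S * !![w, 0; 0, 1]) = ⟨c, 0, c * b, 0, c⟩ := by
    rw [comp_mul]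
    generalize D.comp S = E at *
    ext <;> simp [BinaryQuartic.comp, h1, h3, hc, hb, hw']
    field_simp
  have hsimple := hD.comp hT
  rw [key] at hsimple
  refine ⟨_, hT, c, b, hc ▸ h4, ?_, ?_, key⟩
  · rintro rfl
    obtain ⟨i, hi⟩ := exists_sq_eq (-1 : K)
    refine hsimple !![i, 1; 1, 0] (by simp [Matrix.det_fin_two]) ?_ ?_
    · simp [BinaryQuartic.comp]
      linear_combination (c * i ^ 2 + c) * hi
    · simp [BinaryQuartic.comp]
      linear_combination 4 * c * i * hi
  · rintro rfl
    refine hsimple !![1, 1; 1, 0] (by simp [Matrix.det_fin_two]) ?_ ?_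
    · simp [BinaryQuartic.comp]
      ring
    · simp [BinaryQuartic.comp]
      ring

end BinaryQuartic

/-! ### Biquadratic forms -/

/-- The biquadratic form `x₀²f(y) + x₀x₁g(y) + x₁²h(y)`. -/
structure Biquadratic (K : Type) where
  f : Fin 3 → K
  g : Fin 3 → K
  h : Fin 3 → K

namespace Biquadratic

/-- The value of a biquadratic form. -/
def eval (M : Biquadratic K) (u v : Fin 2 → K) : K :=
  u 0 ^ 2 * quadEval M.f v + u 0 * u 1 * quadEval M.g v + u 1 ^ 2 * quadEval M.h v

/-- The substitution `x ↦ T x` in a biquadratic form. -/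
def comp (M : Biquadratic K) (T : Matrix (Fin 2) (Fin 2) K) : Biquadratic K where
  f := T 0 0 ^ 2 • M.f + (T 0 0 * T 1 0) • M.g + T 1 0 ^ 2 • M.h
  g := (2 * T 0 0 * T 0 1) • M.f + (T 0 0 * T 1 1 + T 0 1 * T 1 0) • M.g +
    (2 * T 1 0 * T 1 1) • M.h
  h := T 0 1 ^ 2 • M.f + (T 0 1 * T 1 1) • M.g + T 1 1 ^ 2 • M.h

/-- The discriminant of a biquadratic form with respect to `y`. -/
def disc (M : Biquadratic K) : BinaryQuartic K where
  e₀ := quadPolar M.f M.f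
  e₁ := 2 * quadPolar M.f M.g
  e₂ := quadPolar M.g M.g + 2 * quadPolar M.f M.h
  e₃ := 2 * quadPolar M.g M.h
  e₄ := quadPolar M.h M.h

theorem eval_comp (M : Biquadratic K) (T : Matrix (Fin 2) (Fin 2) K) (u v : Fin 2 → K) :
    (M.comp T).eval u v = M.eval (T.mulVec u) v := by
  simp [eval, comp, quadEval, Matrix.mulVec, dotProduct, Fin.sum_univ_two]
  ring

theorem disc_comp (M : Biquadratic K) (T : Matrix (Fin 2) (Fin 2) K) :
    (M.comp T).disc = M.disc.comp T := by
  ext <;> simp [disc, comp, quadPolar, BinaryQuartic.comp] <;> ring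

/-- The polynomial of a biquadratic form. -/
noncomputable def toPolynomial (M : Biquadratic K) : MvPolynomial (Fin 2 ⊕ Fin 2) K :=
  X (Sum.inl 0) ^ 2 * (C (M.f 0) * X (Sum.inr 0) ^ 2 +
    C (M.f 1) * X (Sum.inr 0) * X (Sum.inr 1) + C (M.f 2) * X (Sum.inr 1) ^ 2) +
  X (Sum.inl 0) * X (Sum.inl 1) * (C (M.g 0) * X (Sum.inr 0) ^ 2 +
    C (M.g 1) * X (Sum.inr 0) * X (Sum.inr 1) + C (M.g 2) * X (Sum.inr 1) ^ 2) +
  X (Sum.inl 1) ^ 2 * (C (M.h 0) * X (Sum.inr 0) ^ 2 +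
    C (M.h 1) * X (Sum.inr 0) * X (Sum.inr 1) + C (M.h 2) * X (Sum.inr 1) ^ 2)

theorem eval_toPolynomial (M : Biquadratic K) (u v : Fin 2 → K) :
    MvPolynomial.eval (Sum.elim u v) M.toPolynomial = M.eval u v := by
  simp [toPolynomial, eval, quadEval]

theorem exists_eq_toPolynomial {F : MvPolynomial (Fin 2 ⊕ Fin 2) K} (hF : IsBiHomogOf F 2 2) :
    ∃ M : Biquadratic K, F = M.toPolynomial := by
  let mon : ℕ × ℕ → (Fin 2 ⊕ Fin 2 →₀ ℕ) := fun p =>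
    Finsupp.single (Sum.inl 0) (2 - p.1) + Finsupp.single (Sum.inl 1) p.1 +
      Finsupp.single (Sum.inr 0) (2 - p.2) + Finsupp.single (Sum.inr 1) p.2
  have hmon : ∀ p, monomial (mon p) (coeff (mon p) F) = C (coeff (mon p) F) *
      (X (Sum.inl 0) ^ (2 - p.1) * X (Sum.inl 1) ^ p.1 * X (Sum.inr 0) ^ (2 - p.2) *
        X (Sum.inr 1) ^ p.2) := fun p => by
    simp only [mon, X_pow_eq_monomial, monomial_mul, C_mul_monomial, mul_one]
  have hinj : Function.Injective mon := fun p q h => by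
    have h1 := DFunLike.congr_fun h (Sum.inl 1)
    have h2 := DFunLike.congr_fun h (Sum.inr 1)
    simp [mon] at h1 h2
    exact Prod.ext h1 h2
  have hsub : F.support ⊆ (Finset.range 3 ×ˢ Finset.range 3).image mon := fun m hm => by
    have h1 := hF.1 (mem_support_iff.mp hm)
    have h2 := hF.2 (mem_support_iff.mp hm)
    simp [Finsupp.weight_apply, Finsupp.sum_fintype, Fintype.sum_sum_type] at h1 h2
    refine Finset.mem_image.mpr ⟨(m (Sum.inl 1), m (Sum.inr 1)), ?_, ?_⟩
    · simp only [Finset.mem_product, Finset.mem_range]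
      omega
    · ext (i | i) <;> fin_cases i <;> simp [mon] <;> omega
  have hsum : F = ∑ p ∈ Finset.range 3 ×ˢ Finset.range 3,
      monomial (mon p) (coeff (mon p) F) := by
    rw [← Finset.sum_image (f := fun m => monomial m (coeff m F)) hinj.injOn]
    conv_lhs => rw [← support_sum_monomial_coeff F]
    refine Finset.sum_subset hsub fun m _ hm => ?_
    rw [notMem_support_iff.mp hm, monomial_zero]
  refine ⟨⟨fun j => coeff (mon (0, j)) F, fun j => coeff (mon (1, j)) F,
    fun j => coeff (mon (2, j)) F⟩, ?_⟩
  conv_lhs => rw [hsum]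
  simp only [hmon, Finset.sum_product, Finset.sum_range_succ, Finset.sum_range_zero,
    toPolynomial]
  simp
  ring

/-- If the curve is nonsingular, the discriminant has simple roots. -/
theorem disc_hasSimpleRoots [IsAlgClosed K] (h2 : (2 : K) ≠ 0) (M : Biquadratic K)
    (hM : ∀ u v : Fin 2 → K, u ≠ 0 → v ≠ 0 →
      MvPolynomial.eval (Sum.elim u v) M.toPolynomial = 0 →
        ∃ i, MvPolynomial.eval (Sum.elim u v) (pderiv i M.toPolynomial) ≠ 0) :
    M.disc.HasSimpleRoots := by
  intro T hT h0 h1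
  rw [← disc_comp] at h0 h1
  -- a point of the fibre at which `f` is singular and `g` vanishes
  obtain ⟨v, hv, hf0, hf1, hg⟩ : ∃ v : Fin 2 → K, v ≠ 0 ∧
      2 * (M.comp T).f 0 * v 0 + (M.comp T).f 1 * v 1 = 0 ∧
      (M.comp T).f 1 * v 0 + 2 * (M.comp T).f 2 * v 1 = 0 ∧
      quadEval (M.comp T).g v = 0 := by
    generalize M.comp T = N at *
    simp only [disc, quadPolar] at h0 h1
    have h1' := (mul_eq_zero.mp h1).resolve_left h2
    by_cases ha : N.f 0 = 0
    · have hb : N.f 1 = 0 := by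
        have : N.f 1 ^ 2 = 0 := by linear_combination h0 + 4 * N.f 2 * ha
        exact pow_eq_zero_iff (two_ne_zero) |>.mp this
      by_cases hc : N.f 2 = 0
      · by_cases hg0 : N.g 0 = 0
        · exact ⟨![1, 0], by simp, by simp [ha], by simp [hb], by simp [quadEval, hg0]⟩
        · obtain ⟨d, hd⟩ := exists_sq_eq (N.g 1 ^ 2 - 4 * N.g 0 * N.g 2)
          refine ⟨![-N.g 1 + d, 2 * N.g 0], ?_, by simp [ha, hb], by simp [hb, hc], ?_⟩
          · intro h
            have := congrFun h 1
            simp [hg0, h2] at this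
          · simp [quadEval]
            linear_combination N.g 0 * hd
      · have hg0 : N.g 0 = 0 := by
          have : 2 * N.f 2 * N.g 0 = 0 := by
            linear_combination -h1' + N.g 1 * hb - 2 * N.g 2 * ha
          simpa [h2, hc] using this
        exact ⟨![1, 0], by simp, by simp [ha], by simp [hb], by simp [quadEval, hg0]⟩
    · refine ⟨![-N.f 1, 2 * N.f 0], ?_, ?_, ?_, ?_⟩
      · intro h
        have := congrFun h 1
        simp [ha, h2] at this
      · simp
        ring
      · simp
        linear_combination -h0
      · simp [quadEval]
        linear_combination N.g 0 * h0 - 2 * N.f 0 * h1'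
  have hdet : T 0 0 * T 1 1 - T 0 1 * T 1 0 ≠ 0 := by rwa [Matrix.det_fin_two] at hT
  have hu : ![T 0 0, T 1 0] ≠ 0 := by
    intro h
    have e0 : T 0 0 = 0 := congrFun h 0
    have e1 : T 1 0 = 0 := congrFun h 1
    exact hdet (by rw [e0, e1]; ring)
  have hf : quadEval (M.comp T).f v = 0 := by
    have : 2 * quadEval (M.comp T).f v = 0 := by
      simp only [quadEval]
      linear_combination v 0 * hf0 + v 1 * hf1
    exact (mul_eq_zero.mp this).resolve_left h2
  simp [comp, quadEval] at hf0 hf1 hf hg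
  obtain ⟨i, hi⟩ := hM ![T 0 0, T 1 0] v hu hv (by
    rw [eval_toPolynomial]
    simp [eval, quadEval]
    linear_combination hf)
  refine hi ?_
  have hx0 : ∀ a b : K, T 0 0 * a + T 1 0 * b = 0 → T 0 1 * a + T 1 1 * b = 0 →
      a = 0 ∧ b = 0 := fun a b h h' => by
    constructor
    · refine (mul_eq_zero.mp ?_).resolve_left hdet
      linear_combination T 1 1 * h - T 1 0 * h'
    · refine (mul_eq_zero.mp ?_).resolve_left hdet
      linear_combination T 0 0 * h' - T 0 1 * h
  have hx := hx0 (2 * T 0 0 * quadEval M.f v + T 1 0 * quadEval M.g v)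
    (T 0 0 * quadEval M.g v + 2 * T 1 0 * quadEval M.h v)
    (by simp only [quadEval]; linear_combination 2 * hf)
    (by simp only [quadEval]; linear_combination hg)
  simp only [quadEval] at hx
  rcases i with i | i <;> fin_cases i <;>
    simp [toPolynomial, pderiv_X]
  · linear_combination hx.1
  · linear_combination hx.2
  · linear_combination hf0
  · linear_combination hf1

/-- Rohn's normal form for biquadratic forms whose discriminant has simple roots. -/
theorem exists_rohn [IsAlgClosed K] (h2 : (2 : K) ≠ 0) (M : Biquadratic K)
    (hM : M.disc.HasSimpleRoots) :
    ∃ S T : Matrix (Fin 2) (Fin 2) K, S.det ≠ 0 ∧ T.det ≠ 0 ∧ ∃ a₁ a₂ a₃ b : K,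
      a₁ * a₂ ≠ 0 ∧ a₁ * a₂ * b = a₁ ^ 2 + a₂ ^ 2 - a₃ ^ 2 ∧ b ≠ 2 ∧ b ≠ -2 ∧
      ∀ u v, M.eval (S.mulVec u) (T.mulVec v) =
        MvPolynomial.eval (Sum.elim u v) (rohnForm a₁ a₂ a₃) := by
  obtain ⟨S, hS, c, b, hc, hb, hb', hD⟩ := hM.exists_comp_eq h2
  rw [← disc_comp] at hD
  have hev := fun u v => M.eval_comp S u v
  generalize M.comp S = N at *
  have h4 : (4 : K) ≠ 0 := by
    have : (4 : K) = 2 * 2 := by norm_num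
    rw [this]
    exact mul_ne_zero h2 h2
  obtain ⟨e0, e1, e2, e3, e4⟩ := BinaryQuartic.ext_iff.mp hD
  simp only [disc, mul_eq_zero, h2, false_or] at e0 e1 e2 e3 e4
  have polar_add : quadPolar (N.f + N.h) (N.f + N.h) = 2 * (c + quadPolar N.f N.h) := by
    simp only [quadPolar, Pi.add_apply] at e0 e4 ⊢
    linear_combination e0 + e4
  have polar_sub : quadPolar (N.f - N.h) (N.f - N.h) = 2 * (c - quadPolar N.f N.h) := by
    simp only [quadPolar, Pi.sub_apply] at e0 e4 ⊢
    linear_combination e0 + e4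
  obtain ⟨T, hT, p, q, r, hp, hq, hr⟩ := exists_quadComp_triple h2 (N.f + N.h) (N.f - N.h) N.g
    (by
      simp only [quadPolar, Pi.add_apply, Pi.sub_apply] at e0 e4 ⊢
      linear_combination e0 - e4)
    (by
      simp only [quadPolar, Pi.add_apply] at e1 e3 ⊢
      linear_combination e1 + e3)
    (by
      simp only [quadPolar, Pi.sub_apply] at e1 e3 ⊢
      linear_combination e1 - e3)
    (by
      by_contra! h
      rw [polar_add, polar_sub] at h
      have : 4 * c = 0 := by linear_combination h.1 + h.2
      simp [h4, hc] at this)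
    (by
      by_contra! h
      rw [polar_add] at h
      refine hb' (mul_left_cancel₀ hc ?_)
      linear_combination -e2 + h.1 + h.2)
    (by
      by_contra! h
      rw [polar_sub] at h
      refine hb (mul_left_cancel₀ hc ?_)
      linear_combination -e2 - h.1 + h.2)
  have hf : quadComp N.f T = ![(p + q) / 2, 0, (p - q) / 2] := by
    funext i
    have hpi := congrFun hp i
    have hqi := congrFun hq i
    have : 2 * quadComp N.f T i = quadComp (N.f + N.h) T i + quadComp (N.f - N.h) T i := by
      fin_cases i <;> simp [quadComp] <;> ring
    rw [hpi, hqi] at this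
    apply mul_left_cancel₀ h2
    rw [this]
    fin_cases i <;> simp <;> field_simp
    ring
  have hh : quadComp N.h T = ![(p - q) / 2, 0, (p + q) / 2] := by
    funext i
    have hpi := congrFun hp i
    have hqi := congrFun hq i
    have : 2 * quadComp N.h T i = quadComp (N.f + N.h) T i - quadComp (N.f - N.h) T i := by
      fin_cases i <;> simp [quadComp] <;> ring
    rw [hpi, hqi] at this
    apply mul_left_cancel₀ h2
    rw [this]
    fin_cases i <;> simp <;> field_simp
  have pf := quadPolar_comp N.f N.f T
  have pfh := quadPolar_comp N.f N.h T
  have pg := quadPolar_comp N.g N.g T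
  obtain ⟨a₁, ha₁⟩ : ∃ a, a = (p + q) / 2 := ⟨_, rfl⟩
  obtain ⟨a₂, ha₂⟩ : ∃ a, a = (p - q) / 2 := ⟨_, rfl⟩
  obtain ⟨a₃, ha₃⟩ : ∃ a, a = r / 2 := ⟨_, rfl⟩
  have hr' : r = 2 * a₃ := by rw [ha₃]; field_simp
  rw [← ha₁, ← ha₂] at hf hh
  rw [hr'] at hr
  rw [hf, e0] at pf
  rw [hf, hh] at pfh
  rw [hr] at pg
  simp [quadPolar.eq_1 ![_, _, _]] at pf pfh pg
  have hc' : T.det ^ 2 * c ≠ 0 := mul_ne_zero (pow_ne_zero 2 hT) hc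
  refine ⟨S, T, hS, hT, a₁, a₂, a₃, b, ?_, ?_, hb, hb', fun u v => ?_⟩
  · intro h
    exact hc' (by rw [← pf]; linear_combination (-4) * h)
  · apply mul_left_cancel₀ h4
    linear_combination (-b) * pf + pg + 2 * pfh + T.det ^ 2 * e2
  · rw [← hev, eval, ← quadEval_comp, ← quadEval_comp, ← quadEval_comp, hf, hh, hr]
    simp [quadEval, rohnForm]
    ring

end Biquadratic

/-! ### Zero loci -/

/-- A linear change of coordinates in both factors carrying one equation into another carries
the zero loci into each other. -/
theorem image_zeroLocus2_eq {m n : ℕ} {F G : MvPolynomial (Fin m ⊕ Fin n) K}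
    (A : (Fin m → K) ≃ₗ[K] (Fin m → K)) (B : (Fin n → K) ≃ₗ[K] (Fin n → K))
    (h : ∀ u v, eval (Sum.elim (A.symm u) (B.symm v)) F = eval (Sum.elim u v) G) :
    (fun z : PP K m × PP K n => (projMap A z.1, projMap B z.2)) '' zeroLocus2 {F} =
      zeroLocus2 {G} := by
  have hmk : ∀ {k : ℕ} (E : (Fin k → K) ≃ₗ[K] (Fin k → K)) (u : Fin k → K) (hu : u ≠ 0),
      projMap E (Projectivization.mk K u hu) =
        Projectivization.mk K (E u) (E.map_ne_zero_iff.mpr hu) := fun E u hu => rfl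
  ext ⟨x, y⟩
  simp only [zeroLocus2, vanishes2, Set.mem_image, Set.mem_ofPred_eq, Set.mem_singleton_iff,
    forall_eq, Prod.mk.injEq, Prod.exists]
  constructor
  · rintro ⟨a, b, hab, rfl, rfl⟩ u hu v hv hua hvb
    rw [← h]
    refine hab _ (A.symm.map_ne_zero_iff.mpr hu) _ (B.symm.map_ne_zero_iff.mpr hv) ?_ ?_
    · refine Projectivization.map_injective A.toLinearMap A.injective ?_
      change projMap A _ = projMap A a
      rw [hmk, ← hua]
      simp
    · refine Projectivization.map_injective B.toLinearMap B.injective ?_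
      change projMap B _ = projMap B b
      rw [hmk, ← hvb]
      simp
  · intro hG
    induction x using Projectivization.ind with | h u hu => ?_
    induction y using Projectivization.ind with | h v hv => ?_
    refine ⟨.mk K (A.symm u) (A.symm.map_ne_zero_iff.mpr hu),
      .mk K (B.symm v) (B.symm.map_ne_zero_iff.mpr hv), ?_, by simp [hmk], by simp [hmk]⟩
    intro u' hu' v' hv' hu'u hv'v
    have := hG (A u') (A.map_ne_zero_iff.mpr hu') (B v') (B.map_ne_zero_iff.mpr hv')
      (by rw [← hmk A u' hu', hu'u, hmk]; simp) (by rw [← hmk B v' hv', hv'v, hmk]; simp)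
    rw [← h] at this
    simpa using this

theorem statement_18 (K : Type) [Field K] [IsAlgClosed K] (hchar : ringChar K ≠ 2)
    (F : MvPolynomial (Fin 2 ⊕ Fin 2) K)
    (hbideg : IsBiHomogOf F 2 2) (hirr : Irreducible F)
    -- nonsingularity of `E = {F = 0}` (Jacobian criterion):
    (hsmooth : ∀ (u v : Fin 2 → K), u ≠ 0 → v ≠ 0 →
      eval (Sum.elim u v) F = 0 → ∃ i, eval (Sum.elim u v) (pderiv i F) ≠ 0) :
    -- after suitable automorphisms of the two factors, `E` is defined by Rohn's
    -- normal form with `a₁a₂ ≠ 0`, and the discriminant is (up to the nonzero scalar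
    -- `−4a₁a₂`) equal to `x₁⁴ + b·x₁²x₀² + x₀⁴` where `b = (a₁²+a₂²−a₃²)/(a₁a₂)` and
    -- `b ≠ ±2`:
    ∃ (A B : (Fin 2 → K) ≃ₗ[K] (Fin 2 → K)) (a₁ a₂ a₃ b : K),
      a₁ * a₂ ≠ 0 ∧
      ((fun z : PP K 2 × PP K 2 => (projMap A z.1, projMap B z.2)) '' zeroLocus2 {F}) =
        zeroLocus2 {rohnForm a₁ a₂ a₃} ∧
      a₁ * a₂ * b = a₁ ^ 2 + a₂ ^ 2 - a₃ ^ 2 ∧ b ≠ 2 ∧ b ≠ -2 ∧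
      ∃ c : K, c ≠ 0 ∧
        rohnDisc a₁ a₂ a₃ =
          C c * (X 1 ^ 4 + C b * X 0 ^ 2 * X 1 ^ 2 + X 0 ^ 4) := by
  have h2 : (2 : K) ≠ 0 := Ring.two_ne_zero hchar
  obtain ⟨M, rfl⟩ := Biquadratic.exists_eq_toPolynomial hbideg
  obtain ⟨S, T, hS, hT, a₁, a₂, a₃, b, ha, hab, hb, hb', h⟩ :=
    M.exists_rohn h2 (M.disc_hasSimpleRoots h2 hsmooth)
  refine ⟨(S.toLinearEquiv' (S.invertibleOfIsUnitDet hS.isUnit)).symm,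
    (T.toLinearEquiv' (T.invertibleOfIsUnitDet hT.isUnit)).symm, a₁, a₂, a₃, b, ha,
    image_zeroLocus2_eq _ _ fun u v => ?_, hab, hb, hb', -4 * (a₁ * a₂), ?_, ?_⟩
  · rw [Biquadratic.eval_toPolynomial, ← h]
    rfl
  · have : (-4 : K) = -(2 * 2) := by norm_num
    rw [this]
    exact mul_ne_zero (neg_ne_zero.mpr (mul_ne_zero h2 h2)) ha
  · have hC := congrArg (C (σ := Fin 2)) hab
    simp only [map_mul, map_add, map_sub, map_pow] at hC
    simp only [rohnDisc, map_mul, map_neg, map_ofNat]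
    linear_combination (4 * X 0 ^ 2 * X 1 ^ 2) * hC

end RQS
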